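/- arXiv:2011.12816 — 4 statements merged into one kernel-verified Lean document; each statement's English description precedes it below -/
import Mathlib

section
/- Let n ≥ 1, let U be a type of inputs, let φ : ℝⁿ → U → ℝⁿ satisfy a δ-GAS bound with modulus b, and let Λ, ε > 0. Let (S_i)_{i∈ℕ} be subsets of ℝⁿ with union S̄, let U₁ ⊆ U be a nonempty set of admissible inputs with φ(x,u) ∈ S̄ for all x ∈ S̄ and u ∈ U₁, and let ι : ℝⁿ → ℕ be an index map with x ∈ S_{ι(x)} for every x ∈ S̄. For each i ∈ ℕ let μ_i, η_i > 0, let L_i ⊆ S_i be a set of symbolic states, and let Q_i : ℝⁿ → ℝⁿ map S_i into L_i with ‖x − Q_i(x)‖ ≤ Λμ_i/2 for all x ∈ S_i; put X₂ := ⋃_{i∈ℕ} L_i. For each q ∈ X₂ let U₂(q) ⊆ U₁ be a set of symbolic inputs such that for every u₁ ∈ U₁ there exists u₂ ∈ U₂(q) with ‖φ(q,u₁) − φ(q,u₂)‖ ≤ Λη_{ι(q)}. Define the transition system T₁ with state set S̄, all inputs of U₁ enabled at every state, deterministic transitions Δ₁(x,u) = φ(x,u), and identity output map; and the symbolic transition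 system T₂ with state set X₂, enabled inputs U₂(q) at each q ∈ X₂, deterministic transitions Δ₂(q,u) = Q_{ι(φ(q,u))}(φ(q,u)), and identity output map. Assume that b(ε) + Λη_{ι(q)} + Λμ_{ι(φ(q,u))}/2 ≤ ε for every q ∈ X₂ and every u ∈ U₁, and that Λμ_i/2 ≤ ε for every i ∈ ℕ. Then the relation R := {(x,q) ∈ S̄ × X₂ : ‖x − q‖ ≤ ε} is an ε-approximate bisimulation relation (with matched inputs) between T₁ and T₂; moreover R(S̄) = X₂ and R⁻¹(X₂) = S̄. -/
/-- Theorem 1: the relation `R = {(x,q) ∈ S̄ × X₂ : ‖x - q‖ ≤ ε}` is an ε-approximate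
bisimulation relation (with matched inputs) between the sampled concrete system
`T₁ = (S̄, U₁, Δ₁(x,u) = φ x u, id)` and the dynamic symbolic abstraction
`T₂ = (X₂, U₂(·), Δ₂(q,u) = Q_{ι(φ q u)} (φ q u), id)`; moreover `R(S̄) = X₂` and
`R⁻¹(X₂) = S̄`. -/
theorem dynamic_symbolic_abstraction_bisimulation
    {n : ℕ} (hn : 1 ≤ n) {U : Type*}
    (φ : (Fin n → ℝ) → U → (Fin n → ℝ))
    (b : ℝ → ℝ) (hb_mono : Monotone b) (hb0 : b 0 = 0)
    (hGAS : ∀ x y : Fin n → ℝ, ∀ u : U, ‖φ x u - φ y u‖ ≤ b ‖x - y‖)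
    (Λ ε : ℝ) (hΛ : 0 < Λ) (hε : 0 < ε)
    -- the chosen bounded regions and their union S̄
    (S : ℕ → Set (Fin n → ℝ))
    -- admissible inputs
    (U₁ : Set U) (hU₁ne : U₁.Nonempty)
    (hinvariant : ∀ x ∈ ⋃ i, S i, ∀ u ∈ U₁, φ x u ∈ ⋃ i, S i)
    -- index map
    (ι : (Fin n → ℝ) → ℕ) (hι : ∀ x ∈ ⋃ i, S i, x ∈ S (ι x))
    -- quantization parameters
    (μ η : ℕ → ℝ) (hμpos : ∀ i, 0 < μ i) (hηpos : ∀ i, 0 < η i)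
    -- symbolic states and quantizers
    (L : ℕ → Set (Fin n → ℝ)) (hLS : ∀ i, L i ⊆ S i)
    (Q : ℕ → (Fin n → ℝ) → (Fin n → ℝ))
    (hQmem : ∀ i, ∀ x ∈ S i, Q i x ∈ L i)
    (hQerr : ∀ i, ∀ x ∈ S i, ‖x - Q i x‖ ≤ Λ * μ i / 2)
    -- symbolic inputs
    (U₂ : (Fin n → ℝ) → Set U)
    (hU₂sub : ∀ q ∈ ⋃ i, L i, U₂ q ⊆ U₁)
    (hU₂apx : ∀ q ∈ ⋃ i, L i, ∀ u₁ ∈ U₁,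
      ∃ u₂ ∈ U₂ q, ‖φ q u₁ - φ q u₂‖ ≤ Λ * η (ι q))
    -- condition (12)
    (hcond : ∀ q ∈ ⋃ i, L i, ∀ u ∈ U₁,
      b ε + Λ * η (ι q) + Λ * μ (ι (φ q u)) / 2 ≤ ε)
    (hμε : ∀ i, Λ * μ i / 2 ≤ ε) :
    -- R is an ε-approximate bisimulation relation (with matched inputs)
    (∀ x q : Fin n → ℝ,
      (x ∈ ⋃ i, S i ∧ q ∈ ⋃ i, L i ∧ ‖x - q‖ ≤ ε) →
        -- (i) outputs are ε-close (identity output maps)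
        (‖x - q‖ ≤ ε) ∧
        -- (ii) every concrete transition is matched by a symbolic one
        (∀ u₁ ∈ U₁, ∃ u₂ ∈ U₂ q,
          φ x u₁ ∈ ⋃ i, S i ∧ Q (ι (φ q u₂)) (φ q u₂) ∈ ⋃ i, L i ∧
          ‖φ x u₁ - Q (ι (φ q u₂)) (φ q u₂)‖ ≤ ε) ∧
        -- (iii) every symbolic transition is matched by a concrete one
        (∀ u₂ ∈ U₂ q, ∃ u₁ ∈ U₁,
          φ x u₁ ∈ ⋃ i, S i ∧ Q (ι (φ q u₂)) (φ q u₂) ∈ ⋃ i, L i ∧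
          ‖φ x u₁ - Q (ι (φ q u₂)) (φ q u₂)‖ ≤ ε)) ∧
    -- R(S̄) = X₂
    ({q : Fin n → ℝ | ∃ x, x ∈ ⋃ i, S i ∧ q ∈ ⋃ i, L i ∧ ‖x - q‖ ≤ ε}
      = ⋃ i, L i) ∧
    -- R⁻¹(X₂) = S̄
    ({x : Fin n → ℝ | ∃ q, x ∈ ⋃ i, S i ∧ q ∈ ⋃ i, L i ∧ ‖x - q‖ ≤ ε}
      = ⋃ i, S i) := by
  have hsub : ∀ q ∈ ⋃ i, L i, q ∈ ⋃ i, S i := fun q hq => Set.iUnion_mono hLS hq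
  have hquant : ∀ x ∈ ⋃ i, S i, Q (ι x) x ∈ ⋃ i, L i := fun x hx =>
    Set.mem_iUnion.2 ⟨ι x, hQmem _ x (hι x hx)⟩
  have hstep : ∀ x q : Fin n → ℝ, q ∈ ⋃ i, L i → ‖x - q‖ ≤ ε →
      ∀ u₁ : U, ∀ u₂ ∈ U₁, ‖φ q u₁ - φ q u₂‖ ≤ Λ * η (ι q) →
      ‖φ x u₁ - Q (ι (φ q u₂)) (φ q u₂)‖ ≤ ε := by
    intro x q hq hxq u₁ u₂ hu₂ hu
    have hstable := (hGAS x q u₁).trans (hb_mono hxq)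
    have herr := hQerr _ _ (hι _ (hinvariant q (hsub q hq) u₂ hu₂))
    have hbound := hcond q hq u₂ hu₂
    have htri₁ := norm_sub_le_norm_sub_add_norm_sub (φ x u₁) (φ q u₁)
      (Q (ι (φ q u₂)) (φ q u₂))
    have htri₂ := norm_sub_le_norm_sub_add_norm_sub (φ q u₁) (φ q u₂)
      (Q (ι (φ q u₂)) (φ q u₂))
    linarith
  refine ⟨?_, ?_, ?_⟩
  · rintro x q ⟨hx, hq, hxq⟩
    refine ⟨hxq, fun u₁ hu₁ => ?_, fun u₂ hu₂ => ?_⟩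
    · obtain ⟨u₂, hu₂, hu⟩ := hU₂apx q hq u₁ hu₁
      have hu₂' := hU₂sub q hq hu₂
      exact ⟨u₂, hu₂, hinvariant x hx u₁ hu₁, hquant _ (hinvariant q (hsub q hq) u₂ hu₂'),
        hstep x q hq hxq u₁ u₂ hu₂' hu⟩
    · have hu₂' := hU₂sub q hq hu₂
      refine ⟨u₂, hu₂', hinvariant x hx u₂ hu₂', hquant _ (hinvariant q (hsub q hq) u₂ hu₂'),
        hstep x q hq hxq u₂ u₂ hu₂' ?_⟩
      rw [sub_self, norm_zero]
      exact (mul_pos hΛ (hηpos _)).le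
  · ext q
    exact ⟨fun ⟨_, _, hq, _⟩ => hq, fun hq => ⟨q, hsub q hq, hq, by simpa using hε.le⟩⟩
  · ext x
    exact ⟨fun ⟨_, hx, _⟩ => hx,
      fun hx => ⟨Q (ι x) x, hx, hquant x hx, (hQerr _ x (hι x hx)).trans (hμε _)⟩⟩
end

section
/- Let n ≥ 1, let U be a type of inputs, let φ : ℝⁿ → U → ℝⁿ satisfy a δ-GAS bound with modulus b, and let Λ, ε > 0. Let (S_i)_{i∈ℕ} be subsets of ℝⁿ with union S̄, let U₁ ⊆ U be nonempty with φ(x,u) ∈ S̄ for all x ∈ S̄ and u ∈ U₁, and let ι : ℝⁿ → ℕ satisfy x ∈ S_{ι(x)} for every x ∈ S̄. Let Ω_in ∈ (0,1), Ω_out ≥ 1, μ₀, η₀ > 0, and let p : ℕ → ℕ satisfy p_i ≤ i for all i; define μ_i := Ω_in^{p_i}·Ω_out^{i−p_i}·μ₀ and η_i := Ω_in^{p_i}·Ω_out^{i−p_i}·η₀. For each i ∈ ℕ let L_i ⊆ S_i and let Q_i : ℝⁿ → ℝⁿ map S_i into L_i with ‖x − Q_i(x)‖ ≤ Λμ_i/2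 for all x ∈ S_i; put X₂ := ⋃_i L_i. For each q ∈ X₂ let U₂(q) ⊆ U₁ be such that for every u₁ ∈ U₁ there exists u₂ ∈ U₂(q) with ‖φ(q,u₁) − φ(q,u₂)‖ ≤ Λη_{ι(q)}. Define T₁ with state set S̄, all inputs of U₁ enabled, transitions Δ₁(x,u) = φ(x,u), identity output map, and T₂ with state set X₂, enabled inputs U₂(q) at q, transitions Δ₂(q,u) = Q_{ι(φ(q,u))}(φ(q,u)), identity output map. Assume that for every i ∈ ℕ and every natural number p ≤ i, b(ε) + Ω_in^p·Ω_out^{i−p}·(Λη₀ + Λμ₀/2) ≤ ε. Then R := {(x,q) ∈ S̄ × X₂ : ‖x − q‖ ≤ ε} is an ε-approximate bisimulation relation (with matched inputs) between T₁ and T₂, with R(S̄) = X₂ and R⁻¹(X₂) = S̄. -/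
/-- Theorem 2: with the quantization parameters generated by the contraction/expansion
updates `μ_i = Ω_in^{p_i}·Ω_out^{i-p_i}·μ₀`, `η_i = Ω_in^{p_i}·Ω_out^{i-p_i}·η₀`, and
under condition (13), the relation `R = {(x,q) ∈ S̄ × X₂ : ‖x - q‖ ≤ ε}` is an
ε-approximate bisimulation relation (with matched inputs) between the concrete system
and the dynamic symbolic abstraction, with `R(S̄) = X₂` and `R⁻¹(X₂) = S̄`. -/
theorem dynamic_symbolic_abstraction_bisimulation_update_rule
    {n : ℕ} (hn : 1 ≤ n) {U : Type*}
    (φ : (Fin n → ℝ) → U → (Fin n → ℝ))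
    (b : ℝ → ℝ) (hb_mono : Monotone b) (hb0 : b 0 = 0)
    (hGAS : ∀ x y : Fin n → ℝ, ∀ u : U, ‖φ x u - φ y u‖ ≤ b ‖x - y‖)
    (Λ ε : ℝ) (hΛ : 0 < Λ) (hε : 0 < ε)
    -- the chosen bounded regions and their union S̄
    (S : ℕ → Set (Fin n → ℝ))
    -- admissible inputs
    (U₁ : Set U) (hU₁ne : U₁.Nonempty)
    (hinvariant : ∀ x ∈ ⋃ i, S i, ∀ u ∈ U₁, φ x u ∈ ⋃ i, S i)
    -- index map
    (ι : (Fin n → ℝ) → ℕ) (hι : ∀ x ∈ ⋃ i, S i, x ∈ S (ι x))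
    -- contraction/expansion factors and counts of contraction updates
    (Ωin Ωout : ℝ) (hΩin : 0 < Ωin) (hΩin1 : Ωin < 1) (hΩout : 1 ≤ Ωout)
    (μ₀ η₀ : ℝ) (hμ₀ : 0 < μ₀) (hη₀ : 0 < η₀)
    (p : ℕ → ℕ) (hp : ∀ i, p i ≤ i)
    -- quantization parameters generated by the update rules (8)-(9)
    (μ η : ℕ → ℝ)
    (hμdef : ∀ i, μ i = Ωin ^ (p i) * Ωout ^ (i - p i) * μ₀)
    (hηdef : ∀ i, η i = Ωin ^ (p i) * Ωout ^ (i - p i) * η₀)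
    -- symbolic states and quantizers
    (L : ℕ → Set (Fin n → ℝ)) (hLS : ∀ i, L i ⊆ S i)
    (Q : ℕ → (Fin n → ℝ) → (Fin n → ℝ))
    (hQmem : ∀ i, ∀ x ∈ S i, Q i x ∈ L i)
    (hQerr : ∀ i, ∀ x ∈ S i, ‖x - Q i x‖ ≤ Λ * μ i / 2)
    -- symbolic inputs
    (U₂ : (Fin n → ℝ) → Set U)
    (hU₂sub : ∀ q ∈ ⋃ i, L i, U₂ q ⊆ U₁)
    (hU₂apx : ∀ q ∈ ⋃ i, L i, ∀ u₁ ∈ U₁,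
      ∃ u₂ ∈ U₂ q, ‖φ q u₁ - φ q u₂‖ ≤ Λ * η (ι q))
    -- condition (13)
    (hcond : ∀ i : ℕ, ∀ p' ≤ i,
      b ε + Ωin ^ p' * Ωout ^ (i - p') * (Λ * η₀ + Λ * μ₀ / 2) ≤ ε) :
    -- R is an ε-approximate bisimulation relation (with matched inputs)
    (∀ x q : Fin n → ℝ,
      (x ∈ ⋃ i, S i ∧ q ∈ ⋃ i, L i ∧ ‖x - q‖ ≤ ε) →
        -- (i) outputs are ε-close (identity output maps)
        (‖x - q‖ ≤ ε) ∧
        -- (ii) every concrete transition is matched by a symbolic one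
        (∀ u₁ ∈ U₁, ∃ u₂ ∈ U₂ q,
          φ x u₁ ∈ ⋃ i, S i ∧ Q (ι (φ q u₂)) (φ q u₂) ∈ ⋃ i, L i ∧
          ‖φ x u₁ - Q (ι (φ q u₂)) (φ q u₂)‖ ≤ ε) ∧
        -- (iii) every symbolic transition is matched by a concrete one
        (∀ u₂ ∈ U₂ q, ∃ u₁ ∈ U₁,
          φ x u₁ ∈ ⋃ i, S i ∧ Q (ι (φ q u₂)) (φ q u₂) ∈ ⋃ i, L i ∧
          ‖φ x u₁ - Q (ι (φ q u₂)) (φ q u₂)‖ ≤ ε)) ∧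
    -- R(S̄) = X₂
    ({q : Fin n → ℝ | ∃ x, x ∈ ⋃ i, S i ∧ q ∈ ⋃ i, L i ∧ ‖x - q‖ ≤ ε}
      = ⋃ i, L i) ∧
    -- R⁻¹(X₂) = S̄
    ({x : Fin n → ℝ | ∃ q, x ∈ ⋃ i, S i ∧ q ∈ ⋃ i, L i ∧ ‖x - q‖ ≤ ε}
      = ⋃ i, S i) := by
  have hLS' : ∀ q ∈ ⋃ i, L i, q ∈ ⋃ i, S i := fun q hq => Set.iUnion_mono hLS hq
  have hbε : 0 ≤ b ε := hb0 ▸ hb_mono hε.le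
  have hΛη : 0 < Λ * η₀ := mul_pos hΛ hη₀
  have hΛμ : 0 < Λ * μ₀ / 2 := by positivity
  have hΩout0 : 0 < Ωout := by linarith
  have hη_nonneg : ∀ i, 0 ≤ Λ * η i := fun i => by rw [hηdef]; positivity
  have hbudget : ∀ i j, b ε + Λ * η i + Λ * μ j / 2 ≤ ε := by
    intro i j
    have hi := hcond i (p i) (hp i)
    have hj := hcond j (p j) (hp j)
    rw [hηdef, hμdef]
    generalize Ωin ^ p i * Ωout ^ (i - p i) = f at *
    generalize Ωin ^ p j * Ωout ^ (j - p j) = g at *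
    rcases le_total f g with h | h
    · nlinarith [mul_le_mul_of_nonneg_right h hΛη.le]
    · nlinarith [mul_le_mul_of_nonneg_right h hΛμ.le]
  have hQ : ∀ x ∈ ⋃ i, S i, Q (ι x) x ∈ ⋃ i, L i := fun x hx =>
    Set.mem_iUnion_of_mem _ (hQmem _ x (hι x hx))
  have hstep : ∀ x q, ‖x - q‖ ≤ ε → q ∈ ⋃ i, L i → ∀ u₁, ∀ u₂ ∈ U₂ q,
      ‖φ q u₁ - φ q u₂‖ ≤ Λ * η (ι q) →
      ‖φ x u₁ - Q (ι (φ q u₂)) (φ q u₂)‖ ≤ ε := by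
    intro x q hxq hq u₁ u₂ hu₂ hu
    have hmem := hinvariant q (hLS' q hq) u₂ (hU₂sub q hq hu₂)
    have h₁ := (hGAS x q u₁).trans (hb_mono hxq)
    have h₂ := hQerr _ _ (hι _ hmem)
    have h₃ := norm_sub_le_norm_sub_add_norm_sub (φ x u₁) (φ q u₁) (Q (ι (φ q u₂)) (φ q u₂))
    have h₄ := norm_sub_le_norm_sub_add_norm_sub (φ q u₁) (φ q u₂) (Q (ι (φ q u₂)) (φ q u₂))
    linarith [hbudget (ι q) (ι (φ q u₂))]
  refine ⟨?_, ?_, ?_⟩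
  · rintro x q ⟨hx, hq, hxq⟩
    refine ⟨hxq, fun u₁ hu₁ => ?_, fun u₂ hu₂ => ?_⟩
    · obtain ⟨u₂, hu₂, hu⟩ := hU₂apx q hq u₁ hu₁
      exact ⟨u₂, hu₂, hinvariant x hx u₁ hu₁,
        hQ _ (hinvariant q (hLS' q hq) u₂ (hU₂sub q hq hu₂)), hstep x q hxq hq u₁ u₂ hu₂ hu⟩
    · have hu₁ := hU₂sub q hq hu₂
      exact ⟨u₂, hu₁, hinvariant x hx u₂ hu₁, hQ _ (hinvariant q (hLS' q hq) u₂ hu₁),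
        hstep x q hxq hq u₂ u₂ hu₂ (by simpa using hη_nonneg (ι q))⟩
  · ext q
    exact ⟨fun ⟨_, _, hq, _⟩ => hq, fun hq => ⟨q, hLS' q hq, hq, by simpa using hε.le⟩⟩
  · ext x
    refine ⟨fun ⟨_, hx, _, _⟩ => hx, fun hx => ⟨Q (ι x) x, hx, hQ x hx, ?_⟩⟩
    linarith [hQerr _ x (hι x hx), hbudget (ι x) (ι x), hη_nonneg (ι x)]
end

section
/- Let n ≥ 1, let U be a type of inputs, and let φ : ℝⁿ → U → ℝⁿ satisfy a δ-GAS bound with modulus b. Let Λ, μ, η, ε > 0 with b(ε) + Λη + Λμ/2 ≤ ε. Let x, q ∈ ℝⁿ with ‖x − q‖ ≤ ε, let U₁ ⊆ U, let V ⊆ U₁, and let Q : ℝⁿ → ℝⁿ satisfy ‖y − Q(y)‖ ≤ Λμ/2 for every y ∈ ℝⁿ. If for every u₁ ∈ U₁ there exists u₂ ∈ V with ‖φ(q,u₁) − φ(q,u₂)‖ ≤ Λη, then for every u₁ ∈ U₁ there exists u₂ ∈ V such that ‖φ(x,u₁) − Q(φ(q,u₂))‖ ≤ ε. -/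
/-- One-step forward-simulation estimate in the proof of Theorem 1:
`φ x u₁` is the concrete successor, `Q (φ q u₂)` is the symbolic successor obtained by
quantizing with error at most `Λμ/2`, and `V` plays the role of the symbolic input set. -/
theorem forward_simulation_step
    {n : ℕ} (hn : 1 ≤ n) {U : Type*}
    (φ : (Fin n → ℝ) → U → (Fin n → ℝ))
    (b : ℝ → ℝ) (hb_mono : Monotone b) (hb0 : b 0 = 0)
    (hGAS : ∀ x y : Fin n → ℝ, ∀ u : U, ‖φ x u - φ y u‖ ≤ b ‖x - y‖)
    (Λ μ η ε : ℝ) (hΛ : 0 < Λ) (hμ : 0 < μ) (hη : 0 < η) (hε : 0 < ε)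
    (hcond : b ε + Λ * η + Λ * μ / 2 ≤ ε)
    (x q : Fin n → ℝ) (hxq : ‖x - q‖ ≤ ε)
    (U₁ V : Set U) (hV : V ⊆ U₁)
    (Q : (Fin n → ℝ) → (Fin n → ℝ))
    (hQ : ∀ y : Fin n → ℝ, ‖y - Q y‖ ≤ Λ * μ / 2)
    (happrox : ∀ u₁ ∈ U₁, ∃ u₂ ∈ V, ‖φ q u₁ - φ q u₂‖ ≤ Λ * η) :
    ∀ u₁ ∈ U₁, ∃ u₂ ∈ V, ‖φ x u₁ - Q (φ q u₂)‖ ≤ ε := by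
  intro u₁ hu₁
  obtain ⟨u₂, hu₂, hu⟩ := happrox u₁ hu₁
  refine ⟨u₂, hu₂, ?_⟩
  have hxy : ‖φ x u₁ - φ q u₁‖ ≤ b ε := (hGAS x q u₁).trans (hb_mono hxq)
  have hquant := hQ (φ q u₂)
  have h₁ := norm_sub_le_norm_sub_add_norm_sub (φ x u₁) (φ q u₁) (Q (φ q u₂))
  have h₂ := norm_sub_le_norm_sub_add_norm_sub (φ q u₁) (φ q u₂) (Q (φ q u₂))
  linarith
end

section
/- Let n ≥ 1, let U be a type of inputs, and let φ : ℝⁿ → U → ℝⁿ satisfy a δ-GAS bound with modulus b. Let Λ, μ, ε > 0 with b(ε) + Λμ/2 ≤ ε. Let x, q ∈ ℝⁿ with ‖x − q‖ ≤ ε, and let Q : ℝⁿ → ℝⁿ satisfy ‖y − Q(y)‖ ≤ Λμ/2 for every y ∈ ℝⁿ. Then for every input u ∈ U, ‖φ(x,u) − Q(φ(q,u))‖ ≤ ε. -/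
/-- One-step backward-simulation estimate in the proof of Theorem 1:
given a symbolic transition `q' = Q (φ q u)` with quantization error at most `Λμ/2`,
the concrete system matches it by applying the same input `u`. -/
theorem backward_simulation_step
    {n : ℕ} (hn : 1 ≤ n) {U : Type*}
    (φ : (Fin n → ℝ) → U → (Fin n → ℝ))
    (b : ℝ → ℝ) (hb_mono : Monotone b) (hb0 : b 0 = 0)
    (hGAS : ∀ x y : Fin n → ℝ, ∀ u : U, ‖φ x u - φ y u‖ ≤ b ‖x - y‖)
    (Λ μ ε : ℝ) (hΛ : 0 < Λ) (hμ : 0 < μ) (hε : 0 < ε)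
    (hcond : b ε + Λ * μ / 2 ≤ ε)
    (x q : Fin n → ℝ) (hxq : ‖x - q‖ ≤ ε)
    (Q : (Fin n → ℝ) → (Fin n → ℝ))
    (hQ : ∀ y : Fin n → ℝ, ‖y - Q y‖ ≤ Λ * μ / 2) :
    ∀ u : U, ‖φ x u - Q (φ q u)‖ ≤ ε := by
  intro u
  calc ‖φ x u - Q (φ q u)‖
      ≤ ‖φ x u - φ q u‖ + ‖φ q u - Q (φ q u)‖ := norm_sub_le_norm_sub_add_norm_sub ..
    _ ≤ b ε + Λ * μ / 2 := add_le_add ((hGAS x q u).trans (hb_mono hxq)) (hQ _)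
    _ ≤ ε := hcond
end
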